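/- For every h > 0, every c < 0 and every t ∈ ℝ: −(1/(2π)) ∫_{−∞}^{∞} (c+iω)(1 + e^{c+iω}) e^{(c+iω)t + h²(c+iω)²/2} dω = (1/(√(2π) h³)) [t e^{−t²/(2h²)} + (1+t) e^{−(t+1)²/(2h²)}] = (1/(√(2π) h³)) e^{−(t+1)²/(2h²)} (1 + t + t e^{(2t+1)/(2h²)}). -/

import Mathlib

open MeasureTheory Set

/-- A Gaussian exponential along a vertical line, as the exponential of a real quadratic. -/
lemma cexp_vertical_gaussian_eq (h c s ω : ℝ) :
    Complex.exp (((c:ℂ) + Complex.I * (ω:ℂ)) * (s:ℂ)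
        + (h:ℂ) ^ 2 * ((c:ℂ) + Complex.I * (ω:ℂ)) ^ 2 / 2)
      = Complex.exp ((-(h:ℂ) ^ 2 / 2) * (ω:ℂ) ^ 2
          + (Complex.I * ((s:ℂ) + (h:ℂ) ^ 2 * (c:ℂ))) * (ω:ℂ)
          + ((c:ℂ) * (s:ℂ) + (h:ℂ) ^ 2 * (c:ℂ) ^ 2 / 2)) := by
  congr 1
  linear_combination ((h:ℂ) ^ 2 * (ω:ℂ) ^ 2 / 2) * Complex.I_sq

lemma neg_sq_div_two_re_neg {h : ℝ} (hh : 0 < h) : (-(h:ℂ) ^ 2 / 2).re < 0 := by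
  have e : (-(h:ℂ) ^ 2 / 2) = ((-h ^ 2 / 2 : ℝ) : ℂ) := by push_cast; ring
  rw [e, Complex.ofReal_re]
  have := pow_pos hh 2
  linarith

lemma integrable_cexp_vertical_gaussian {h : ℝ} (hh : 0 < h) (c s : ℝ) :
    Integrable fun ω : ℝ => Complex.exp (((c:ℂ) + Complex.I * (ω:ℂ)) * (s:ℂ)
        + (h:ℂ) ^ 2 * ((c:ℂ) + Complex.I * (ω:ℂ)) ^ 2 / 2) := by
  simp_rw [cexp_vertical_gaussian_eq]
  exact integrable_cexp_quadratic' (neg_sq_div_two_re_neg hh) _ _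

lemma integral_cexp_vertical_gaussian {h : ℝ} (hh : 0 < h) (c s : ℝ) :
    ∫ ω : ℝ, Complex.exp (((c:ℂ) + Complex.I * (ω:ℂ)) * (s:ℂ)
        + (h:ℂ) ^ 2 * ((c:ℂ) + Complex.I * (ω:ℂ)) ^ 2 / 2)
      = ((Real.sqrt (2 * Real.pi) / h * Real.exp (-s ^ 2 / (2 * h ^ 2)) : ℝ) : ℂ) := by
  simp_rw [cexp_vertical_gaussian_eq]
  rw [integral_cexp_quadratic (neg_sq_div_two_re_neg hh)]
  have hne : (h:ℂ) ≠ 0 := by exact_mod_cast hh.ne'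
  have e1 : (Real.pi : ℂ) / -(-(h:ℂ) ^ 2 / 2) = ((2 * Real.pi / h ^ 2 : ℝ) : ℂ) := by
    push_cast; field_simp
  have e2 : ((2 * Real.pi / h ^ 2 : ℝ) : ℂ) ^ (1 / 2 : ℂ)
      = ((Real.sqrt (2 * Real.pi) / h : ℝ) : ℂ) := by
    rw [← Real.sqrt_sq hh.le, ← Real.sqrt_div (by positivity), Real.sqrt_sq hh.le,
      Real.sqrt_eq_rpow, Complex.ofReal_cpow (by positivity)]
    norm_num
  rw [e1, e2, Complex.ofReal_mul, Complex.ofReal_exp]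
  congr 2
  push_cast
  rw [mul_pow, Complex.I_sq]
  field_simp
  ring

lemma integrable_mul_cexp_vertical_gaussian {h : ℝ} (hh : 0 < h) (c s : ℝ) :
    Integrable fun ω : ℝ => ((c:ℂ) + Complex.I * (ω:ℂ)) *
      Complex.exp (((c:ℂ) + Complex.I * (ω:ℂ)) * (s:ℂ)
        + (h:ℂ) ^ 2 * ((c:ℂ) + Complex.I * (ω:ℂ)) ^ 2 / 2) := by
  have hω : Integrable fun ω : ℝ => (ω:ℂ) *
      Complex.exp (((c:ℂ) + Complex.I * (ω:ℂ)) * (s:ℂ)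
        + (h:ℂ) ^ 2 * ((c:ℂ) + Complex.I * (ω:ℂ)) ^ 2 / 2) := by
    have hb : 0 < h ^ 2 / 2 := by positivity
    refine ((integrable_mul_exp_neg_mul_sq hb).norm.const_mul
      (Real.exp (c * s + h ^ 2 * c ^ 2 / 2))).mono' (by fun_prop) (ae_of_all _ fun ω => ?_)
    rw [norm_mul, norm_mul, Complex.norm_exp, Complex.norm_real, Real.norm_eq_abs (Real.exp _),
      Real.abs_exp, mul_left_comm, ← Real.exp_add]
    refine le_of_eq ?_
    congr 2
    simp [pow_two]
    ring
  refine (((integrable_cexp_vertical_gaussian hh c s).const_mul (c:ℂ)).add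
    (hω.const_mul Complex.I)).congr (ae_of_all _ fun ω => ?_)
  simp only [Pi.add_apply]
  ring

/-- The first moment of a Gaussian exponential along a vertical line. -/
lemma integral_mul_cexp_vertical_gaussian {h : ℝ} (hh : 0 < h) (c s : ℝ) :
    ∫ ω : ℝ, ((c:ℂ) + Complex.I * (ω:ℂ)) *
      Complex.exp (((c:ℂ) + Complex.I * (ω:ℂ)) * (s:ℂ)
        + (h:ℂ) ^ 2 * ((c:ℂ) + Complex.I * (ω:ℂ)) ^ 2 / 2)
      = ((-(s / h ^ 2) * (Real.sqrt (2 * Real.pi) / h * Real.exp (-s ^ 2 / (2 * h ^ 2))) : ℝ)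
          : ℂ) := by
  have hF := integrable_cexp_vertical_gaussian hh c s
  have hzF := integrable_mul_cexp_vertical_gaussian hh c s
  have hderiv (ω : ℝ) : HasDerivAt (fun ω : ℝ => Complex.exp
      (((c:ℂ) + Complex.I * (ω:ℂ)) * (s:ℂ) + (h:ℂ) ^ 2 * ((c:ℂ) + Complex.I * (ω:ℂ)) ^ 2 / 2))
      ((Complex.I * s) * Complex.exp
        (((c:ℂ) + Complex.I * (ω:ℂ)) * (s:ℂ) + (h:ℂ) ^ 2 * ((c:ℂ) + Complex.I * (ω:ℂ)) ^ 2 / 2)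
        + (Complex.I * h ^ 2) * (((c:ℂ) + Complex.I * (ω:ℂ)) * Complex.exp
        (((c:ℂ) + Complex.I * (ω:ℂ)) * (s:ℂ)
          + (h:ℂ) ^ 2 * ((c:ℂ) + Complex.I * (ω:ℂ)) ^ 2 / 2))) ω := by
    have hz : HasDerivAt (fun ω : ℝ => (c:ℂ) + Complex.I * (ω:ℂ)) Complex.I ω := by
      simpa using ((Complex.ofRealCLM.hasDerivAt (x := ω)).const_mul Complex.I).const_add (c:ℂ)
    refine ((hz.mul_const (s:ℂ)).add
      (((hz.pow 2).const_mul ((h:ℂ) ^ 2)).div_const 2)).cexp.congr_deriv ?_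
    simp only [Pi.add_apply, Pi.pow_apply]
    push_cast
    ring
  have hzero := integral_eq_zero_of_hasDerivAt_of_integrable hderiv
    ((hF.const_mul _).add (hzF.const_mul _)) hF
  rw [integral_add (hF.const_mul _) (hzF.const_mul _), integral_const_mul, integral_const_mul,
    integral_cexp_vertical_gaussian hh] at hzero
  have hne : (h:ℂ) ≠ 0 := by exact_mod_cast hh.ne'
  rw [Complex.ofReal_mul]
  generalize ((Real.sqrt (2 * Real.pi) / h * Real.exp (-s ^ 2 / (2 * h ^ 2)) : ℝ) : ℂ) = G at *
  generalize (∫ ω : ℝ, ((c:ℂ) + Complex.I * (ω:ℂ)) *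
      Complex.exp (((c:ℂ) + Complex.I * (ω:ℂ)) * (s:ℂ)
        + (h:ℂ) ^ 2 * ((c:ℂ) + Complex.I * (ω:ℂ)) ^ 2 / 2)) = J at *
  have hsum : (s:ℂ) * G + (h:ℂ) ^ 2 * J = 0 := by
    refine (mul_eq_zero.mp ?_).resolve_left Complex.I_ne_zero
    rw [← hzero]
    ring
  push_cast
  field_simp
  linear_combination hsum

/-- Explicit deconvolution kernel for on/off switching arrival rate:
`−(1/2π) ∫ (c+iω)(1+e^{c+iω}) e^{(c+iω)t + h²(c+iω)²/2} dω
  = (1/(√(2π)h³)) [t e^{−t²/(2h²)} + (1+t) e^{−(t+1)²/(2h²)}]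
  = (1/(√(2π)h³)) e^{−(t+1)²/(2h²)} (1 + t + t e^{(2t+1)/(2h²)})`. -/
theorem statement19 (h c t : ℝ) (hh : 0 < h) (hc : c < 0) :
    -(1 / (2 * (Real.pi : ℂ))) *
        (∫ ω : ℝ, ((c:ℂ) + Complex.I * (ω:ℂ)) *
          (1 + Complex.exp ((c:ℂ) + Complex.I * (ω:ℂ))) *
          Complex.exp (((c:ℂ) + Complex.I * (ω:ℂ)) * (t:ℂ)
            + (h:ℂ) ^ 2 * ((c:ℂ) + Complex.I * (ω:ℂ)) ^ 2 / 2))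
      = (((1 / (Real.sqrt (2 * Real.pi) * h ^ 3)) *
          (t * Real.exp (-t ^ 2 / (2 * h ^ 2))
            + (1 + t) * Real.exp (-(t + 1) ^ 2 / (2 * h ^ 2))) : ℝ) : ℂ) ∧
    (1 / (Real.sqrt (2 * Real.pi) * h ^ 3)) *
        (t * Real.exp (-t ^ 2 / (2 * h ^ 2))
          + (1 + t) * Real.exp (-(t + 1) ^ 2 / (2 * h ^ 2)))
      = (1 / (Real.sqrt (2 * Real.pi) * h ^ 3)) * Real.exp (-(t + 1) ^ 2 / (2 * h ^ 2)) *
          (1 + t + t * Real.exp ((2 * t + 1) / (2 * h ^ 2))) := by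
  constructor
  · have hsplit (ω : ℝ) : ((c:ℂ) + Complex.I * (ω:ℂ)) *
          (1 + Complex.exp ((c:ℂ) + Complex.I * (ω:ℂ))) *
          Complex.exp (((c:ℂ) + Complex.I * (ω:ℂ)) * (t:ℂ)
            + (h:ℂ) ^ 2 * ((c:ℂ) + Complex.I * (ω:ℂ)) ^ 2 / 2)
        = ((c:ℂ) + Complex.I * (ω:ℂ)) *
          Complex.exp (((c:ℂ) + Complex.I * (ω:ℂ)) * (t:ℂ)
            + (h:ℂ) ^ 2 * ((c:ℂ) + Complex.I * (ω:ℂ)) ^ 2 / 2)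
        + ((c:ℂ) + Complex.I * (ω:ℂ)) *
          Complex.exp (((c:ℂ) + Complex.I * (ω:ℂ)) * ((t + 1 : ℝ):ℂ)
            + (h:ℂ) ^ 2 * ((c:ℂ) + Complex.I * (ω:ℂ)) ^ 2 / 2) := by
      rw [mul_assoc, one_add_mul, mul_add, ← Complex.exp_add]
      congr 3
      push_cast
      ring
    simp_rw [hsplit]
    rw [integral_add (integrable_mul_cexp_vertical_gaussian hh c t)
      (integrable_mul_cexp_vertical_gaussian hh c (t + 1)),
      integral_mul_cexp_vertical_gaussian hh, integral_mul_cexp_vertical_gaussian hh]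
    norm_cast
    have hsq : Real.sqrt (2 * Real.pi) ^ 2 = 2 * Real.pi := Real.sq_sqrt (by positivity)
    field_simp
    rw [hsq]
    ring
  · have hexp : Real.exp (-t ^ 2 / (2 * h ^ 2))
        = Real.exp (-(t + 1) ^ 2 / (2 * h ^ 2)) * Real.exp ((2 * t + 1) / (2 * h ^ 2)) := by
      rw [← Real.exp_add]
      congr 1
      ring
    rw [hexp]
    ring
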